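/- Let f ∈ K[x₁,…,xₙ] be a homogeneous polynomial with zero Hessian, fⱼ = ∂f/∂xⱼ, and let g ∈ ker φ be a nonzero homogeneous polynomial of least degree, where φ : K[y₁,…,yₙ] → K[x₁,…,xₙ] is the K-algebra map yⱼ ↦ fⱼ. Set hⱼ = (∂g/∂yⱼ)(f₁,…,fₙ). Then: (a) Σⱼ hⱼ·(∂f/∂xⱼ) = 0; (b) Σ_k h_k·(∂fⱼ/∂x_k) = 0 for every j (i.e., the vector (h₁,…,hₙ) annihilates the Hessian matrix of f); (c) Σ_k (∂h_k/∂xⱼ)·f_k = 0 for every j; (d) the system h = (h₁,…,hₙ) is self-vanishing, i.e., Σᵢ hᵢ·(∂hⱼ/∂xᵢ) = 0 for all j. -/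

import Mathlib

open MvPolynomial

namespace MvPolynomial

/-- The chain rule for partial derivatives of a polynomial composition. -/
theorem pderiv_aeval_eq_sum {R σ τ : Type*} [CommSemiring R] [Fintype σ]
    (v : σ → MvPolynomial τ R) (p : MvPolynomial σ R) (i : τ) :
    pderiv i (aeval v p) = ∑ k, aeval v (pderiv k p) * pderiv i (v k) := by
  classical
  induction p using MvPolynomial.induction_on with
  | C a => simp
  | add p q hp hq => simp [-aeval_eq_bind₁, hp, hq, add_mul, Finset.sum_add_distrib]
  | mul_X p m hp =>
    simp [-aeval_eq_bind₁, hp, Derivation.leibniz, pderiv_X, Pi.single_apply, add_mul,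
      Finset.sum_add_distrib, Finset.mul_sum, mul_assoc, apply_ite]

/-- Partial derivatives of polynomials commute. -/
theorem pderiv_pderiv_comm {R σ : Type*} [CommRing R] (i j : σ) (p : MvPolynomial σ R) :
    pderiv i (pderiv j p) = pderiv j (pderiv i p) := by
  classical
  have key : ⁅pderiv (R := R) i, pderiv (R := R) j⁆ = 0 := by
    ext k
    simp [Derivation.commutator_apply, pderiv_X, Pi.single_apply, apply_ite]
  exact sub_eq_zero.mp <| by
    rw [← Derivation.commutator_apply, key, Derivation.zero_apply]

end MvPolynomial

/-- Let `f` be a homogeneous form with zero Hessian, `g` a nonzero homogeneous polynomial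
of least degree with `g(f₁,…,fₙ) = 0` where `fⱼ = ∂f/∂xⱼ`, and set
`hⱼ = (∂g/∂yⱼ)(f₁,…,fₙ)`.  Then (a) `h` is a syzygy of the gradient of `f`;
(b) `h` annihilates the Hessian matrix of `f`; (c) `∑ₖ (∂hₖ/∂xⱼ)·fₖ = 0` for every `j`;
(d) `h` is a self-vanishing system. -/
theorem svs_arising_from_form_with_zero_hessian
    {K : Type*} [Field K] [IsAlgClosed K] [CharZero K] {n : ℕ}
    (f : MvPolynomial (Fin n) K) (d : ℕ) (hf : f.IsHomogeneous d)
    (hHess : (Matrix.of fun i j : Fin n => pderiv i (pderiv j f)).det = 0)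
    (g : MvPolynomial (Fin n) K) (e : ℕ) (hg0 : g ≠ 0) (hge : g.IsHomogeneous e)
    (hker : aeval (fun j : Fin n => pderiv j f) g = 0)
    (hmin : ∀ (g' : MvPolynomial (Fin n) K) (e' : ℕ), g' ≠ 0 → g'.IsHomogeneous e' →
      aeval (fun j : Fin n => pderiv j f) g' = 0 → e ≤ e')
    (h : Fin n → MvPolynomial (Fin n) K)
    (hh : ∀ j, h j = aeval (fun k : Fin n => pderiv k f) (pderiv j g)) :
    (∑ j, h j * pderiv j f = 0) ∧
    (∀ j, ∑ k, h k * pderiv k (pderiv j f) = 0) ∧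
    (∀ j, ∑ k, pderiv j (h k) * pderiv k f = 0) ∧
    (∀ j, ∑ i, h i * pderiv i (h j) = 0) := by
  have ha : ∑ j, h j * pderiv j f = 0 := by
    have := congrArg (aeval fun j : Fin n => pderiv j f) hge.sum_X_mul_pderiv
    simpa [-aeval_eq_bind₁, hker, ← hh, mul_comm] using this
  have hb : ∀ j, ∑ k, h k * pderiv k (pderiv j f) = 0 := fun j => by
    have := pderiv_aeval_eq_sum (fun k : Fin n => pderiv k f) g j
    rw [hker, map_zero] at this
    simp_rw [hh, this, pderiv_pderiv_comm _ j]
  refine ⟨ha, hb, fun j => ?_, fun j => ?_⟩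
  · have := congrArg (pderiv j) ha
    simpa [Derivation.leibniz, Finset.sum_add_distrib, pderiv_pderiv_comm j, hb, mul_comm]
      using this
  · calc ∑ i, h i * pderiv i (h j)
        = ∑ k, aeval (fun k : Fin n => pderiv k f) (pderiv k (pderiv j g)) *
            ∑ i, h i * pderiv i (pderiv k f) := by
          simp_rw [hh j, pderiv_aeval_eq_sum, Finset.mul_sum]
          rw [Finset.sum_comm]
          simp_rw [mul_left_comm]
      _ = 0 := by simp [hb]
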